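/- arXiv:1711.05994 — 2 statements merged into one kernel-verified Lean document; each statement's English description precedes it below -/
import Mathlib

section
/- Let A be a minimal WFA of dimension n realizing f ∈ ℓ²(Σ), with well-defined Gramians G_p and G_s. Let G_s = L_s L_sᵀ and G_p = L_p L_pᵀ be Cholesky decompositions and let L_pᵀL_s = U D Vᵀ be a singular value decomposition. Then Q = L_p^{−ᵀ} U D^{1/2} is invertible with Q^{−1} = D^{1/2} Vᵀ L_s^{−1}, and the conjugated automaton B = A^Q = ⟨Qᵀα, Q^{−1}β, {Q^{−1}A_aQ}⟩ is a singular value automaton for f; in particular the Gramians of B satisfy G_{B,p} = G_{B,s} = D. -/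
open scoped ENNReal
open scoped Kronecker
open Matrix

noncomputable section

/-- A weighted finite automaton of dimension `n` over alphabet `S`,
with initial weights, final weights and transition matrices. -/
structure WFA (S : Type*) (n : ℕ) where
  init : Fin n → ℝ
  final : Fin n → ℝ
  trans : S → Matrix (Fin n) (Fin n) ℝ

namespace WFA

variable {S : Type*} {n : ℕ}

/-- `A_x = A_{x₁} ⋯ A_{x_t}` (identity for the empty string). -/
def matOf (M : WFA S n) (x : List S) : Matrix (Fin n) (Fin n) ℝ :=
  (x.map M.trans).prod

/-- The function computed by the WFA: `f_A(x) = αᵀ A_x β`. -/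
def f (M : WFA S n) (x : List S) : ℝ :=
  M.init ⬝ᵥ (M.matOf x).mulVec M.final

/-- Row `p` of the forward matrix: `αᵀ A_p`. -/
def fwd (M : WFA S n) (x : List S) : Fin n → ℝ :=
  Matrix.vecMul M.init (M.matOf x)

/-- Row `s` of the backward matrix: `(A_s β)ᵀ`. -/
def bwd (M : WFA S n) (x : List S) : Fin n → ℝ :=
  (M.matOf x).mulVec M.final

/-- `M` is a minimal WFA: no WFA of strictly smaller dimension computes the same function. -/
def Min (M : WFA S n) : Prop :=
  ∀ m : ℕ, (∃ B : WFA S m, B.f = M.f) → n ≤ m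

/-- The reachability Gramian `G_p = Pᵀ P` is well-defined: all its defining sums converge. -/
def GpDefined (M : WFA S n) : Prop :=
  ∀ i j, Summable fun x : List S => M.fwd x i * M.fwd x j

/-- The observability Gramian `G_s = Sᵀ S` is well-defined: all its defining sums converge. -/
def GsDefined (M : WFA S n) : Prop :=
  ∀ i j, Summable fun x : List S => M.bwd x i * M.bwd x j

/-- The reachability Gramian `G_p = Pᵀ P`. -/
def Gp (M : WFA S n) : Matrix (Fin n) (Fin n) ℝ :=
  Matrix.of fun i j => ∑' x : List S, M.fwd x i * M.fwd x j

/-- The observability Gramian `G_s = Sᵀ S`. -/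
def Gs (M : WFA S n) : Matrix (Fin n) (Fin n) ℝ :=
  Matrix.of fun i j => ∑' x : List S, M.bwd x i * M.bwd x j

/-- Truncation of a WFA to its first `m` states. -/
def trunc (M : WFA S n) (m : ℕ) (h : m ≤ n) : WFA S m where
  init := fun i => M.init (Fin.castLE h i)
  final := fun i => M.final (Fin.castLE h i)
  trans := fun a => Matrix.of fun i j => M.trans a (Fin.castLE h i) (Fin.castLE h j)

end WFA

/-- A function `f : Σ* → ℝ` is rational if it is computed by some WFA. -/
def IsRational {S : Type*} (f : List S → ℝ) : Prop :=
  ∃ (n : ℕ) (M : WFA S n), M.f = f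

/-- Spectral radius of a real square matrix: the largest modulus of its complex eigenvalues. -/
def specRad {d : Type*} [Fintype d] [DecidableEq d] (M : Matrix d d ℝ) : ℝ≥0∞ :=
  spectralRadius ℂ (M.map (algebraMap ℝ ℂ))

/-- Induced ∞-norm of a matrix: maximum absolute row sum. -/
def normInfM {d e : Type*} [Fintype d] [Fintype e] (M : Matrix d e ℝ) : ℝ :=
  ⨆ i, ∑ j, |M i j|

/-- Induced 1-norm of a matrix: maximum absolute column sum. -/
def normOneM {d e : Type*} [Fintype d] [Fintype e] (M : Matrix d e ℝ) : ℝ :=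
  ⨆ j, ∑ i, |M i j|

/-- The `p`-norm of a finite-dimensional real vector, `1 ≤ p ≤ ∞`. -/
def vecPNorm {d : Type*} [Fintype d] (p : ℝ≥0∞) (v : d → ℝ) : ℝ :=
  if p = ⊤ then ⨆ i, |v i| else (∑ i, |v i| ^ p.toReal) ^ (1 / p.toReal)

/-- The induced matrix `p`-norm `‖M‖_p = sup_{‖v‖_p = 1} ‖Mv‖_p`. -/
def inducedPNorm {d : Type*} [Fintype d] (p : ℝ≥0∞) (M : Matrix d d ℝ) : ℝ :=
  sSup {r | ∃ v : d → ℝ, vecPNorm p v = 1 ∧ r = vecPNorm p (M.mulVec v)}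

/-- The operator norm of the Hankel operator of `f` on `ℓ²`. -/
def hankelOpNorm {S : Type*} (f : List S → ℝ) : ℝ :=
  sSup {r | ∃ g : List S → ℝ, (Summable fun y => g y ^ 2) ∧ (∑' y, g y ^ 2) ≤ 1 ∧
    (Summable fun x : List S => (∑' y : List S, f (x ++ y) * g y) ^ 2) ∧
    r = Real.sqrt (∑' x : List S, (∑' y : List S, f (x ++ y) * g y) ^ 2)}

end

/-- If the entries `∑ u k * u l` of a Gram matrix converge to `G`, those of the family obtained by
multiplying each row by `Q` converge to `Qᵀ * G * Q`. -/
theorem hasSum_vecMul_gram {ι m : Type*} [Fintype m] {u : ι → m → ℝ} {G : Matrix m m ℝ}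
    (hG : ∀ k l, HasSum (fun x => u x k * u x l) (G k l)) (Q : Matrix m m ℝ) (i j : m) :
    HasSum (fun x => vecMul (u x) Q i * vecMul (u x) Q j) ((Qᵀ * G * Q) i j) := by
  have h : HasSum (fun x => ∑ l, ∑ k, Q k i * (u x k * u x l) * Q l j)
      (∑ l, ∑ k, Q k i * G k l * Q l j) :=
    hasSum_sum fun l _ => hasSum_sum fun k _ => ((hG k l).mul_left _).mul_right _
  convert h using 1
  · funext x
    simp only [vecMul, dotProduct]
    rw [Finset.sum_mul_sum, Finset.sum_comm]
    exact Finset.sum_congr rfl fun l _ => Finset.sum_congr rfl fun k _ => by ring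
  · simp only [mul_apply, transpose_apply, Finset.sum_mul]

namespace WFA

variable {S : Type*} {n : ℕ}

/-- The conjugate `A^Q`, with `Qi` in the role of `Q⁻¹`. -/
noncomputable def conj (M : WFA S n) (Q Qi : Matrix (Fin n) (Fin n) ℝ) : WFA S n :=
  ⟨vecMul M.init Q, Qi.mulVec M.final, fun a => Qi * M.trans a * Q⟩

variable (M : WFA S n) {Q Qi : Matrix (Fin n) (Fin n) ℝ}

theorem matOf_conj (h : Q * Qi = 1) (x : List S) :
    (M.conj Q Qi).matOf x = Qi * M.matOf x * Q := by
  have h' : Qi * Q = 1 := mul_eq_one_comm.mp h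
  induction x with
  | nil => simp [matOf, h']
  | cons a x ih =>
    have hc (N : WFA S n) : N.matOf (a :: x) = N.trans a * N.matOf x := by simp [matOf]
    rw [hc, hc, ih]
    calc Qi * M.trans a * Q * (Qi * M.matOf x * Q)
        = Qi * M.trans a * (Q * Qi) * M.matOf x * Q := by simp only [Matrix.mul_assoc]
      _ = Qi * (M.trans a * M.matOf x) * Q := by
        rw [h, Matrix.mul_one]; simp only [Matrix.mul_assoc]

theorem fwd_conj (h : Q * Qi = 1) (x : List S) :
    (M.conj Q Qi).fwd x = vecMul (M.fwd x) Q := by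
  rw [fwd, matOf_conj M h, fwd, conj, vecMul_vecMul, vecMul_vecMul, ← Matrix.mul_assoc,
    ← Matrix.mul_assoc, h, Matrix.one_mul]

theorem bwd_conj (h : Q * Qi = 1) (x : List S) :
    (M.conj Q Qi).bwd x = Qi.mulVec (M.bwd x) := by
  rw [bwd, matOf_conj M h, bwd, conj, mulVec_mulVec, mulVec_mulVec, Matrix.mul_assoc, h,
    Matrix.mul_one]

theorem f_conj (h : Q * Qi = 1) : (M.conj Q Qi).f = M.f := by
  funext x
  change (M.conj Q Qi).init ⬝ᵥ (M.conj Q Qi).bwd x = M.init ⬝ᵥ M.bwd x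
  rw [bwd_conj M h, conj, ← dotProduct_mulVec, mulVec_mulVec, h, one_mulVec]

variable {M}

theorem hasSum_fwd_conj (h : Q * Qi = 1) (hM : M.GpDefined) (i j : Fin n) :
    HasSum (fun x => (M.conj Q Qi).fwd x i * (M.conj Q Qi).fwd x j)
      ((Qᵀ * M.Gp * Q) i j) := by
  simp only [fwd_conj M h]
  exact hasSum_vecMul_gram (fun k l => (hM k l).hasSum) Q i j

theorem hasSum_bwd_conj (h : Q * Qi = 1) (hM : M.GsDefined) (i j : Fin n) :
    HasSum (fun x => (M.conj Q Qi).bwd x i * (M.conj Q Qi).bwd x j)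
      ((Qi * M.Gs * Qiᵀ) i j) := by
  simp only [bwd_conj M h, ← vecMul_transpose]
  simpa only [transpose_transpose] using
    hasSum_vecMul_gram (G := M.Gs) (fun k l => (hM k l).hasSum) Qiᵀ i j

theorem GpDefined.conj (h : Q * Qi = 1) (hM : M.GpDefined) : (M.conj Q Qi).GpDefined :=
  fun i j => (hasSum_fwd_conj h hM i j).summable

theorem GsDefined.conj (h : Q * Qi = 1) (hM : M.GsDefined) : (M.conj Q Qi).GsDefined :=
  fun i j => (hasSum_bwd_conj h hM i j).summable

theorem Gp_conj (h : Q * Qi = 1) (hM : M.GpDefined) :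
    (M.conj Q Qi).Gp = Qᵀ * M.Gp * Q :=
  Matrix.ext fun i j => (hasSum_fwd_conj h hM i j).tsum_eq

theorem Gs_conj (h : Q * Qi = 1) (hM : M.GsDefined) :
    (M.conj Q Qi).Gs = Qi * M.Gs * Qiᵀ :=
  Matrix.ext fun i j => (hasSum_bwd_conj h hM i j).tsum_eq

end WFA

/-- computing the SVA from Cholesky factors of the Gramians and an SVD of
`L_pᵀ L_s`: `Q = L_p^{−ᵀ} U D^{1/2}` is invertible with inverse `D^{1/2} Vᵀ L_s^{−1}`, and
the conjugate `B = A^Q` is an SVA, i.e. both its Gramians equal `D`. -/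
theorem computeSVA_correct {S : Type*} [Fintype S] {n : ℕ} (M : WFA S n)
    (hmin : M.Min) (hl2 : Summable fun x : List S => M.f x ^ 2)
    (hGpd : M.GpDefined) (hGsd : M.GsDefined)
    (Lp Ls : Matrix (Fin n) (Fin n) ℝ)
    (hLp : M.Gp = Lp * Lpᵀ) (hLs : M.Gs = Ls * Lsᵀ)
    (hLptri : ∀ i j : Fin n, i < j → Lp i j = 0)
    (hLstri : ∀ i j : Fin n, i < j → Ls i j = 0)
    (U V : Matrix (Fin n) (Fin n) ℝ) (σ : Fin n → ℝ)
    (hU : Uᵀ * U = 1) (hV : Vᵀ * V = 1)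
    (hσpos : ∀ i, 0 < σ i) (hσmono : ∀ i j : Fin n, i ≤ j → σ j ≤ σ i)
    (hsvd : Lpᵀ * Ls = U * Matrix.diagonal σ * Vᵀ) :
    ∀ Q Qi : Matrix (Fin n) (Fin n) ℝ,
      Q = (Lp⁻¹)ᵀ * U * Matrix.diagonal (fun i => Real.sqrt (σ i)) →
      Qi = Matrix.diagonal (fun i => Real.sqrt (σ i)) * Vᵀ * Ls⁻¹ →
      ∀ B : WFA S n,
        B = ⟨Matrix.vecMul M.init Q, Qi.mulVec M.final, fun a => Qi * M.trans a * Q⟩ →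
        Q * Qi = 1 ∧ Qi * Q = 1 ∧ B.f = M.f ∧ B.GpDefined ∧ B.GsDefined ∧
          B.Gp = Matrix.diagonal σ ∧ B.Gs = Matrix.diagonal σ := by
  rintro Q Qi hQ hQi B hB
  set D := Matrix.diagonal fun i => Real.sqrt (σ i) with hDdef
  have hD : D * D = Matrix.diagonal σ := by
    simp only [hDdef, diagonal_mul_diagonal, Real.mul_self_sqrt (hσpos _).le]
  have hDT : Dᵀ = D := diagonal_transpose _
  have hdet : IsUnit (Lpᵀ * Ls).det := by
    have hσ : (Matrix.diagonal σ).det ≠ 0 := by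
      rw [det_diagonal]
      exact Finset.prod_ne_zero_iff.mpr fun i _ => (hσpos i).ne'
    rw [hsvd, det_mul, det_mul]
    exact ((isUnit_det_of_left_inverse hU).mul hσ.isUnit).mul
      (isUnit_det_of_right_inverse hV)
  rw [det_mul, det_transpose, IsUnit.mul_iff] at hdet
  obtain ⟨hLpu, hLsu⟩ := hdet
  have hone : Q * Qi = 1 := by
    calc Q * Qi = (Lp⁻¹)ᵀ * (U * (D * D) * Vᵀ) * Ls⁻¹ := by
          rw [hQ, hQi]; simp only [Matrix.mul_assoc]
      _ = (Lp * Lp⁻¹)ᵀ * (Ls * Ls⁻¹) := by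
          rw [hD, ← hsvd, transpose_mul]; simp only [Matrix.mul_assoc]
      _ = 1 := by
          rw [mul_nonsing_inv _ hLpu, mul_nonsing_inv _ hLsu, transpose_one, Matrix.one_mul]
  have hGp : Qᵀ * M.Gp * Q = Matrix.diagonal σ := by
    calc Qᵀ * M.Gp * Q = D * (Uᵀ * ((Lp⁻¹ * Lp) * (Lp⁻¹ * Lp)ᵀ) * U) * D := by
          rw [hQ, hLp]; simp only [transpose_mul, transpose_transpose, hDT, Matrix.mul_assoc]
      _ = Matrix.diagonal σ := by
          rw [nonsing_inv_mul _ hLpu, transpose_one, Matrix.mul_one, Matrix.mul_one, hU,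
            Matrix.mul_one, hD]
  have hGs : Qi * M.Gs * Qiᵀ = Matrix.diagonal σ := by
    calc Qi * M.Gs * Qiᵀ = D * (Vᵀ * ((Ls⁻¹ * Ls) * (Ls⁻¹ * Ls)ᵀ) * V) * D := by
          rw [hQi, hLs]; simp only [transpose_mul, transpose_transpose, hDT, Matrix.mul_assoc]
      _ = Matrix.diagonal σ := by
          rw [nonsing_inv_mul _ hLsu, transpose_one, Matrix.mul_one, Matrix.mul_one, hV,
            Matrix.mul_one, hD]
  obtain rfl : B = M.conj Q Qi := hB
  exact ⟨hone, mul_eq_one_comm.mp hone, M.f_conj hone, hGpd.conj hone, hGsd.conj hone,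
    (WFA.Gp_conj hone hGpd).trans hGp, (WFA.Gs_conj hone hGsd).trans hGs⟩
end

section
/- Let A be a WFA computing f ∈ ℓ²(Σ) of rank n, let A' be an SVA for f, and let Â = Γ A' Γᵀ be the truncation of A' to n̂ < n states, i.e. Â = ⟨α̂, β̂, {Â_a}⟩ where α̂, β̂ are the first n̂ entries of the initial/final vectors of A' and Â_a is the top-left n̂×n̂ block of A'_a. Then the function f̂ computed by Â satisfies Σ_{x∈Σ*} f̂(x)² < ∞ and Σ_{x∈Σ*} f̂(x)² ≤ Σ_{x∈Σ*} f(x)². -/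
open scoped ENNReal
open scoped Kronecker
open Matrix

namespace WFA

variable {S : Type*} {n : ℕ}

theorem bwd_cons (M : WFA S n) (a : S) (x : List S) :
    M.bwd (a :: x) = M.trans a *ᵥ M.bwd x := by
  simp [bwd, matOf, Matrix.mulVec_mulVec]

theorem bwd_nil (M : WFA S n) : M.bwd [] = M.final := by
  simp [bwd, matOf]

/-- The quadratic form `vᵀ G_s v` of the observability Gramian, with values in `[0, ∞]`. -/
noncomputable def energy (M : WFA S n) (v : Fin n → ℝ) : ℝ≥0∞ :=
  ∑' x : List S, ENNReal.ofReal ((v ⬝ᵥ M.bwd x) ^ 2)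

end WFA

/-- A list is either empty or has a head and a tail. -/
def unitSumProdEquivList (S : Type*) : Unit ⊕ S × List S ≃ List S where
  toFun o := o.elim (fun _ => []) fun p => p.1 :: p.2
  invFun l := match l with
    | [] => .inl ()
    | a :: x => .inr (a, x)
  left_inv o := by cases o <;> rfl
  right_inv l := by cases l <;> rfl

theorem ENNReal.tsum_list_eq {S : Type*} [Fintype S] (F : List S → ℝ≥0∞) :
    ∑' x, F x = F [] + ∑ a, ∑' x, F (a :: x) := by
  rw [← (unitSumProdEquivList S).tsum_eq F,
    Summable.tsum_sum ENNReal.summable ENNReal.summable, ← tsum_fintype (L := .unconditional S),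
    ← ENNReal.tsum_prod, tsum_fintype]
  simp [unitSumProdEquivList]

namespace WFA

variable {S : Type*} {n : ℕ}

theorem energy_eq [Fintype S] (M : WFA S n) (v : Fin n → ℝ) :
    M.energy v = ENNReal.ofReal ((v ⬝ᵥ M.final) ^ 2) + ∑ a, M.energy (v ᵥ* M.trans a) := by
  simp only [energy]
  rw [ENNReal.tsum_list_eq]
  simp [bwd_cons, bwd_nil, Matrix.dotProduct_mulVec]

/-- A supersolution of the Lyapunov equation dominates the observability Gramian. -/
theorem energy_le_of_supersolution [Fintype S] (M : WFA S n) (Q : (Fin n → ℝ) → ℝ≥0∞)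
    (hQ : ∀ v, ENNReal.ofReal ((v ⬝ᵥ M.final) ^ 2) + ∑ a, Q (v ᵥ* M.trans a) ≤ Q v)
    (v : Fin n → ℝ) : M.energy v ≤ Q v := by
  have key : ∀ (t : ℕ) (v : Fin n → ℝ),
      (∑' x : List S, if x.length < t then ENNReal.ofReal ((v ⬝ᵥ M.bwd x) ^ 2) else 0) ≤ Q v := by
    intro t
    induction t with
    | zero => simp
    | succ t ih =>
      intro v
      refine le_trans ?_ (hQ v)
      rw [ENNReal.tsum_list_eq]
      simp only [List.length_nil, Nat.succ_pos, if_true, bwd_nil, List.length_cons,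
        Nat.succ_lt_succ_iff, bwd_cons, Matrix.dotProduct_mulVec]
      gcongr with a
      exact ih _
  refine ENNReal.summable.tsum_le_of_sum_le fun s => ?_
  refine le_trans ?_ (key (s.sup List.length + 1) v)
  refine le_trans (Finset.sum_le_sum fun x hx => ?_) (ENNReal.sum_le_tsum s)
  rw [if_pos (Nat.lt_succ_of_le (Finset.le_sup hx))]

theorem energy_init (M : WFA S n) :
    M.energy M.init = ∑' x, ENNReal.ofReal (M.f x ^ 2) := rfl

/-- If the columns of the backward matrix are orthogonal with squared norms `σ`, then the
observability Gramian is `diag σ`. -/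
theorem energy_eq_of_bwd (M : WFA S n) (V : List S → Fin n → ℝ) (σ : Fin n → ℝ)
    (hVsum : ∀ i j, Summable fun x : List S => V x i * V x j)
    (hVorth : ∀ i j, (∑' x : List S, V x i * V x j) = if i = j then (1 : ℝ) else 0)
    (hσ : ∀ i, 0 ≤ σ i) (hbwd : ∀ s i, M.bwd s i = V s i * Real.sqrt (σ i)) (v : Fin n → ℝ) :
    M.energy v = ENNReal.ofReal (∑ i, σ i * v i ^ 2) := by
  have hsum : HasSum (fun x => (v ⬝ᵥ M.bwd x) ^ 2) (∑ i, σ i * v i ^ 2) := by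
    have h : HasSum (fun x => ∑ i, ∑ j, (v i * √(σ i) * (v j * √(σ j))) * (V x i * V x j))
        (∑ i, ∑ j, (v i * √(σ i) * (v j * √(σ j))) * (if i = j then (1 : ℝ) else 0)) :=
      hasSum_sum fun i _ => hasSum_sum fun j _ =>
        (hVorth i j ▸ (hVsum i j).hasSum).mul_left _
    convert h using 1
    · funext x
      rw [sq, dotProduct, Finset.sum_mul_sum]
      refine Finset.sum_congr rfl fun i _ => Finset.sum_congr rfl fun j _ => ?_
      rw [hbwd, hbwd]
      ring
    · refine Finset.sum_congr rfl fun i _ => ?_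
      simp only [mul_ite, mul_one, mul_zero, Finset.sum_ite_eq, Finset.mem_univ, if_true]
      rw [mul_mul_mul_comm, Real.mul_self_sqrt (hσ i)]
      ring
  rw [energy, ← hsum.tsum_eq, ENNReal.ofReal_tsum_of_nonneg (fun _ => sq_nonneg _) hsum.summable]

/-- Truncating a WFA whose observability Gramian is diagonal decreases the Gramian. -/
theorem energy_trunc_le [Fintype S] (M : WFA S n) (σ : Fin n → ℝ) (hσ : ∀ i, 0 ≤ σ i)
    (hM : ∀ v, M.energy v = ENNReal.ofReal (∑ i, σ i * v i ^ 2)) (m : ℕ) (h : m ≤ n)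
    (v : Fin m → ℝ) :
    (M.trunc m h).energy v ≤ ENNReal.ofReal (∑ i, σ (Fin.castLE h i) * v i ^ 2) := by
  have hinj : Function.Injective (Fin.castLE h) := Fin.castLE_injective h
  refine energy_le_of_supersolution _
    (fun v => ENNReal.ofReal (∑ i, σ (Fin.castLE h i) * v i ^ 2)) (fun v => ?_) v
  set w : Fin n → ℝ := Function.extend (Fin.castLE h) v 0
  have hw : ∀ i, w (Fin.castLE h i) = v i := fun i => hinj.extend_apply _ _ _
  have hw0 : ∀ i, i ∉ Set.range (Fin.castLE h) → w i = 0 := fun i hi =>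
    Function.extend_apply' _ _ _ hi
  have hdot : ∀ u : Fin n → ℝ, v ⬝ᵥ (fun i => u (Fin.castLE h i)) = w ⬝ᵥ u := fun u =>
    Fintype.sum_of_injective _ hinj _ _ (fun i hi => by simp [hw0 i hi]) fun i => by rw [hw]
  have hQ : ∑ i, σ (Fin.castLE h i) * v i ^ 2 = ∑ i, σ i * w i ^ 2 :=
    Fintype.sum_of_injective _ hinj _ _ (fun i hi => by simp [hw0 i hi]) fun i => by rw [hw]
  rw [hQ, ← hM, energy_eq]
  simp only [hM]
  refine add_le_add (le_of_eq ?_) (Finset.sum_le_sum fun a _ => ENNReal.ofReal_le_ofReal ?_)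
  · rw [← hdot]
    rfl
  · calc ∑ i, σ (Fin.castLE h i) * (v ᵥ* (M.trunc m h).trans a) i ^ 2
        = ∑ i, σ (Fin.castLE h i) * (w ᵥ* M.trans a) (Fin.castLE h i) ^ 2 := by
          refine Finset.sum_congr rfl fun i _ => ?_
          congr 2
          exact hdot fun j => M.trans a j (Fin.castLE h i)
      _ = ∑ i ∈ Finset.univ.map ⟨Fin.castLE h, hinj⟩, σ i * (w ᵥ* M.trans a) i ^ 2 := by
          simp
      _ ≤ ∑ i, σ i * (w ᵥ* M.trans a) i ^ 2 :=
          Finset.sum_le_sum_of_subset_of_nonneg (Finset.subset_univ _)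
            fun i _ _ => mul_nonneg (hσ i) (sq_nonneg _)

end WFA

/-- SVA truncation reduces the `ℓ²` norm: if `A'` is an SVA for `f ∈ ℓ²` of
rank `n` and `Â` its truncation to `n̂ < n` states, then `f̂ = f_Â` satisfies
`f̂ ∈ ℓ²` and `‖f̂‖₂ ≤ ‖f‖₂`. -/
theorem sva_truncation_norm_le {S : Type*} [Fintype S] {n : ℕ} (f : List S → ℝ)
    (hl2 : Summable fun x : List S => f x ^ 2)
    (hrank : ∀ m : ℕ, (∃ B : WFA S m, B.f = f) → n ≤ m)
    (A' : WFA S n) (hA'f : A'.f = f)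
    (U V : List S → Fin n → ℝ) (σ : Fin n → ℝ)
    (hUsum : ∀ i j, Summable fun x : List S => U x i * U x j)
    (hVsum : ∀ i j, Summable fun x : List S => V x i * V x j)
    (hUorth : ∀ i j, (∑' x : List S, U x i * U x j) = if i = j then (1 : ℝ) else 0)
    (hVorth : ∀ i j, (∑' x : List S, V x i * V x j) = if i = j then (1 : ℝ) else 0)
    (hσpos : ∀ i, 0 < σ i) (hσmono : ∀ i j : Fin n, i ≤ j → σ j ≤ σ i)
    (hsvd : ∀ p s : List S, f (p ++ s) = ∑ i : Fin n, U p i * σ i * V s i)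
    (hfwd : ∀ p i, A'.fwd p i = U p i * Real.sqrt (σ i))
    (hbwd : ∀ s i, A'.bwd s i = V s i * Real.sqrt (σ i))
    (nh : ℕ) (hnh : nh < n) :
    (Summable fun x : List S => (A'.trunc nh hnh.le).f x ^ 2) ∧
      (∑' x : List S, (A'.trunc nh hnh.le).f x ^ 2) ≤ ∑' x : List S, f x ^ 2 := by
  have hσ : ∀ i, 0 ≤ σ i := fun i => (hσpos i).le
  have hM := A'.energy_eq_of_bwd V σ hVsum hVorth hσ hbwd
  have hle : ∑' x, ENNReal.ofReal ((A'.trunc nh hnh.le).f x ^ 2) ≤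
      ENNReal.ofReal (∑' x, f x ^ 2) := by
    rw [ENNReal.ofReal_tsum_of_nonneg (fun _ => sq_nonneg _) hl2, ← hA'f, ← WFA.energy_init,
      ← WFA.energy_init, hM]
    refine (A'.energy_trunc_le σ hσ hM nh hnh.le _).trans (ENNReal.ofReal_le_ofReal ?_)
    calc ∑ i, σ (Fin.castLE hnh.le i) * A'.init (Fin.castLE hnh.le i) ^ 2
        = ∑ i ∈ Finset.univ.map ⟨Fin.castLE hnh.le, Fin.castLE_injective hnh.le⟩,
            σ i * A'.init i ^ 2 := by simp
      _ ≤ ∑ i, σ i * A'.init i ^ 2 :=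
          Finset.sum_le_sum_of_subset_of_nonneg (Finset.subset_univ _)
            fun i _ _ => mul_nonneg (hσ i) (sq_nonneg _)
  have hsum : Summable fun x : List S => (A'.trunc nh hnh.le).f x ^ 2 := by
    have h := ENNReal.summable_toReal (hle.trans_lt ENNReal.ofReal_lt_top).ne
    simpa only [ENNReal.toReal_ofReal (sq_nonneg _)] using h
  refine ⟨hsum, ?_⟩
  rwa [← ENNReal.ofReal_tsum_of_nonneg (fun _ => sq_nonneg _) hsum,
    ENNReal.ofReal_le_ofReal_iff (tsum_nonneg fun _ => sq_nonneg _)] at hle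
end
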